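/- arXiv:2105.10354 — 2 statements merged into one kernel-verified Lean document; each statement's English description precedes it below -/
import Mathlib

section
/- Let k be a triangular number. Then for every natural number ℓ with 0 ≤ ℓ ≤ ⌊k/2⌋, the binary representation of the triangular number t_{2^k - 2^ℓ} contains exactly k ones; in particular, t_{2^k - 2^ℓ} is very triangular. -/
/-- The n-th triangular number. -/
def triangular (n : ℕ) : ℕ := n * (n + 1) / 2

/-- A natural number is triangular if it is `triangular n` for some `n`. -/
def IsTriangular (m : ℕ) : Prop := ∃ n : ℕ, triangular n = m

/-- The number of 1s in the binary representation of `m` (binary digit sum). -/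
def binOnes (m : ℕ) : ℕ := (Nat.digits 2 m).sum

/-- A number is very triangular if it is triangular and its binary digit sum is triangular. -/
def IsVeryTriangular (m : ℕ) : Prop := IsTriangular m ∧ IsTriangular (binOnes m)

theorem binOnes_zero : binOnes 0 = 0 := by simp [binOnes]

theorem binOnes_two_mul (n : ℕ) : binOnes (2 * n) = binOnes n := by
  rcases Nat.eq_zero_or_pos n with rfl | h
  · rfl
  · simp [binOnes, Nat.digits_def' (b := 2) (n := 2 * n) (by norm_num) (by omega)]

theorem binOnes_two_mul_add_one (n : ℕ) : binOnes (2 * n + 1) = binOnes n + 1 := by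
  have h : (2 * n + 1) / 2 = n := by omega
  have h' : (2 * n + 1) % 2 = 1 := by omega
  rw [binOnes, Nat.digits_def' (by norm_num) (by omega), h, h', List.sum_cons, binOnes, add_comm]

theorem binOnes_two_pow_mul_add (a : ℕ) :
    ∀ n r : ℕ, r < 2 ^ a → binOnes (2 ^ a * n + r) = binOnes n + binOnes r := by
  induction a with
  | zero =>
    intro n r hr
    obtain rfl : r = 0 := by simpa using hr
    simp [binOnes_zero]
  | succ a ih =>
    intro n r hr
    have hpow : 2 ^ (a + 1) = 2 * 2 ^ a := pow_succ' 2 a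
    obtain ⟨s, rfl | rfl⟩ := Nat.even_or_odd' r
    · have e : 2 ^ (a + 1) * n + 2 * s = 2 * (2 ^ a * n + s) := by ring
      rw [e, binOnes_two_mul, binOnes_two_mul, ih n s (by omega)]
    · have e : 2 ^ (a + 1) * n + (2 * s + 1) = 2 * (2 ^ a * n + s) + 1 := by ring
      rw [e, binOnes_two_mul_add_one, binOnes_two_mul_add_one, ih n s (by omega), add_assoc]

theorem binOnes_two_pow_mul (a n : ℕ) : binOnes (2 ^ a * n) = binOnes n := by
  simpa [binOnes_zero] using binOnes_two_pow_mul_add a n 0 (by positivity)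

theorem binOnes_two_pow_sub_one (a : ℕ) : binOnes (2 ^ a - 1) = a := by
  induction a with
  | zero => simp [binOnes_zero]
  | succ a ih =>
    have hpos : 0 < 2 ^ a := by positivity
    have e : 2 ^ (a + 1) - 1 = 2 * (2 ^ a - 1) + 1 := by rw [pow_succ']; omega
    rw [e, binOnes_two_mul_add_one, ih]

theorem two_mul_triangular (n : ℕ) : 2 * triangular n = n * (n + 1) :=
  Nat.mul_div_cancel' (Nat.even_mul_succ_self n).two_dvd

theorem binOnes_triangular_two_pow_sub {k l : ℕ} (hl : l ≤ k / 2) :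
    binOnes (triangular (2 ^ k - 2 ^ l)) = k := by
  rcases Nat.eq_zero_or_pos k with rfl | hk
  · obtain rfl : l = 0 := by omega
    simp [triangular, binOnes_zero]
  obtain ⟨j, rfl⟩ : ∃ j, k = l + (j + 1) := ⟨k - l - 1, by omega⟩
  have hlj : l ≤ j + 1 := by omega
  have key : 2 * triangular (2 ^ (l + (j + 1)) - 2 ^ l) =
      2 ^ l * (2 ^ (l + j + 2) * (2 ^ j - 1) + (2 ^ (j + 1) * 1 + (2 ^ l - 1))) := by
    rw [two_mul_triangular]
    have hj : 1 ≤ 2 ^ j := Nat.one_le_two_pow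
    have hL : 1 ≤ 2 ^ l := Nat.one_le_two_pow
    have hle : 2 ^ l ≤ 2 ^ (l + (j + 1)) := Nat.pow_le_pow_right (by norm_num) (by omega)
    zify [hj, hL, hle]
    ring
  have hlow : 2 ^ l - 1 < 2 ^ (j + 1) := by
    have := Nat.pow_le_pow_right (n := 2) (by norm_num) hlj
    have : 0 < 2 ^ l := by positivity
    omega
  have hmid : 2 ^ (j + 1) * 1 + (2 ^ l - 1) < 2 ^ (l + j + 2) := by
    have := Nat.pow_le_pow_right (n := 2) (by norm_num) (show j + 2 ≤ l + j + 2 by omega)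
    have : 2 ^ (j + 2) = 2 * 2 ^ (j + 1) := pow_succ' 2 (j + 1)
    omega
  have hone : binOnes 1 = 1 := binOnes_two_pow_sub_one 1
  rw [← binOnes_two_mul, key, binOnes_two_pow_mul, binOnes_two_pow_mul_add _ _ _ hmid,
    binOnes_two_pow_mul_add _ _ _ hlow, binOnes_two_pow_sub_one, binOnes_two_pow_sub_one, hone]
  omega

theorem stmt2 (k : ℕ) (hk : IsTriangular k) (ℓ : ℕ) (hℓ : ℓ ≤ k / 2) :
    binOnes (triangular (2 ^ k - 2 ^ ℓ)) = k ∧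
      IsVeryTriangular (triangular (2 ^ k - 2 ^ ℓ)) := by
  have h := binOnes_triangular_two_pow_sub hℓ
  exact ⟨h, ⟨_, rfl⟩, by rwa [h]⟩
end

section
/- There are infinitely many natural numbers j such that the six consecutive triangular numbers t_j, t_{j+1}, t_{j+2}, t_{j+3}, t_{j+4}, t_{j+5} are all very triangular. -/
theorem binOnes_eq_mod_add_div (n : ℕ) : binOnes n = n % 2 + binOnes (n / 2) := by
  rcases Nat.eq_zero_or_pos n with rfl | hn
  · simp [binOnes]
  · rw [binOnes, Nat.digits_def' one_lt_two hn, List.sum_cons, binOnes]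

/-- Binary digit sums add up when the binary representations do not overlap. -/
theorem binOnes_add_two_pow_mul (k m n : ℕ) (hm : m < 2 ^ k) :
    binOnes (m + 2 ^ k * n) = binOnes m + binOnes n := by
  induction k generalizing m with
  | zero =>
    obtain rfl : m = 0 := by simpa using hm
    simp [binOnes]
  | succ k ih =>
    have hsplit : m + 2 ^ (k + 1) * n = m + 2 * (2 ^ k * n) := by ring
    have hmod : (m + 2 * (2 ^ k * n)) % 2 = m % 2 := by omega
    have hdiv : (m + 2 * (2 ^ k * n)) / 2 = m / 2 + 2 ^ k * n := by omega
    rw [binOnes_eq_mod_add_div (m + _), binOnes_eq_mod_add_div m, hsplit, hmod, hdiv,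
      ih (m / 2) (by rw [pow_succ] at hm; omega), add_assoc]

theorem triangular_two_pow_mul_add (a c k : ℕ) :
    triangular (a * 2 ^ (k + 1) + c) =
      triangular c + 2 ^ k * (a * (2 * c + 1) + 2 ^ (k + 1) * a ^ 2) := by
  have h := two_mul_triangular (a * 2 ^ (k + 1) + c)
  have hc := two_mul_triangular c
  have hring : (a * 2 ^ (k + 1) + c) * (a * 2 ^ (k + 1) + c + 1) =
      c * (c + 1) + 2 * (2 ^ k * (a * (2 * c + 1) + 2 ^ (k + 1) * a ^ 2)) := by ring
  omega

theorem binOnes_triangular_two_pow_mul_add (a c k : ℕ) (hc : triangular c < 2 ^ k)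
    (ha : a * (2 * c + 1) < 2 ^ (k + 1)) :
    binOnes (triangular (a * 2 ^ (k + 1) + c)) =
      binOnes (triangular c) + (binOnes (a * (2 * c + 1)) + binOnes (a ^ 2)) := by
  rw [triangular_two_pow_mul_add, binOnes_add_two_pow_mul _ _ _ hc,
    binOnes_add_two_pow_mul _ _ _ ha]

theorem stmt13 :
    {j : ℕ | ∀ ℓ ≤ 5, IsVeryTriangular (triangular (j + ℓ))}.Infinite := by
  refine Set.infinite_of_injective_forall_mem
    (f := fun k : ℕ => 28505 * 2 ^ (k + 20 + 1) + 5) ?_ ?_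
  · intro k l h
    have hpow : 2 ^ (k + 20 + 1) = 2 ^ (l + 20 + 1) := by
      simp only at h
      omega
    have := Nat.pow_right_injective le_rfl hpow
    omega
  · intro k ℓ hℓ
    refine ⟨⟨_, rfl⟩, 7, ?_⟩
    have hk : 2 ^ 20 ≤ 2 ^ (k + 20) := Nat.pow_le_pow_right two_pos (by omega)
    have hk' : 2 ^ (k + 20 + 1) = 2 * 2 ^ (k + 20) := by ring
    rw [add_assoc, binOnes_triangular_two_pow_mul_add]
    · interval_cases ℓ <;> norm_num [triangular, binOnes]
    · interval_cases ℓ <;> norm_num [triangular] <;> omega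
    · omega
end
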